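/- (Robust counterpart of the loss-coverage constraint under the affine decision rule.) Let T ≥ 2, α_1, …, α_T ∈ ℝ, β_2, …, β_T ∈ ℝ, and δ ∈ ℝ. The robust constraint '∑_{t=1}^T p_t − ∑_{t=1}^T l_t ≥ δ for all l ∈ U^CLT', with p_1 = α_1 and p_t = α_t + β_t·l_{t−1} for 2 ≤ t ≤ T, holds if and only if there exist s₁, s₂ ≥ 0 with s₁ − s₂ ≥ 1 − β_t for all 2 ≤ t ≤ T, s₁ − s₂ ≥ 1, and −∑_{t=1}^T α_t + (T·m̄ + γ₂·σ·√T)·s₁ + (γ₂·σ·√T − T·m̄)·s₂ ≤ −δ; equivalently, if and only if ∑_{t=1}^T α_t ≥ δ + L^CLT · max(1, max_{2≤t≤T} (1 − β_t)). -/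

import Mathlib

/-- The CLT uncertainty set: losses `l : {1,…,T} → ℝ` with `l t ≥ 0` and
`|∑_{t=1}^T l t − T·m̄| ≤ γ₂·σ·√T`. -/
def UCLT (T : ℕ) (m σ γ₂ : ℝ) (l : ℕ → ℝ) : Prop :=
  (∀ t ∈ Finset.Icc 1 T, 0 ≤ l t) ∧
    |(∑ t ∈ Finset.Icc 1 T, l t) - (T : ℝ) * m| ≤ γ₂ * σ * Real.sqrt T

/-- `L^CLT = T·m̄ + γ₂·σ·√T`. -/
noncomputable def LCLT (T : ℕ) (m σ γ₂ : ℝ) : ℝ :=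
  (T : ℝ) * m + γ₂ * σ * Real.sqrt T

theorem UCLT.sum_le {T : ℕ} {m σ γ₂ : ℝ} {l : ℕ → ℝ} (h : UCLT T m σ γ₂ l) :
    ∑ t ∈ Finset.Icc 1 T, l t ≤ LCLT T m σ γ₂ := by
  have := (abs_le.mp h.2).2
  unfold LCLT
  linarith

theorem LCLT_nonneg {T : ℕ} {m σ γ₂ : ℝ} (hm : 0 ≤ m) (hσ : 0 ≤ σ) (hγ : 0 ≤ γ₂) :
    0 ≤ LCLT T m σ γ₂ := by
  unfold LCLT
  positivity

/-- Concentrating the maximal total loss in a single period is admissible. -/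
theorem UCLT_single {T k : ℕ} {m σ γ₂ : ℝ} (hm : 0 ≤ m) (hσ : 0 ≤ σ) (hγ : 0 ≤ γ₂)
    (hk : k ∈ Finset.Icc 1 T) : UCLT T m σ γ₂ (Pi.single k (LCLT T m σ γ₂)) := by
  refine ⟨fun t _ => ?_, ?_⟩
  · rw [Pi.single_apply]
    split_ifs
    exacts [LCLT_nonneg hm hσ hγ, le_rfl]
  · rw [Finset.sum_pi_single', if_pos hk, LCLT, add_sub_cancel_left, abs_of_nonneg (by positivity)]

/-- The worst case of a linear cost over the CLT uncertainty set puts all the loss on a period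
of maximal cost, provided that this maximal cost is nonnegative. -/
theorem forall_UCLT_sum_mul_le_iff {T : ℕ} {m σ γ₂ : ℝ} (hm : 0 ≤ m) (hσ : 0 ≤ σ) (hγ : 0 ≤ γ₂)
    {c : ℕ → ℝ} {M b : ℝ} (hM : 0 ≤ M) (hle : ∀ t ∈ Finset.Icc 1 T, c t ≤ M)
    (hex : ∃ t ∈ Finset.Icc 1 T, c t = M) :
    (∀ l, UCLT T m σ γ₂ l → ∑ t ∈ Finset.Icc 1 T, c t * l t ≤ b) ↔ LCLT T m σ γ₂ * M ≤ b := by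
  constructor
  · intro h
    obtain ⟨k, hk, rfl⟩ := hex
    have := h _ (UCLT_single hm hσ hγ hk)
    simpa [Pi.single_apply, hk, (Finset.mem_Icc.mp hk).1, (Finset.mem_Icc.mp hk).2, mul_comm]
      using this
  · intro h l hl
    calc ∑ t ∈ Finset.Icc 1 T, c t * l t ≤ ∑ t ∈ Finset.Icc 1 T, M * l t :=
          Finset.sum_le_sum fun t ht => mul_le_mul_of_nonneg_right (hle t ht) (hl.1 t ht)
      _ = M * ∑ t ∈ Finset.Icc 1 T, l t := (Finset.mul_sum _ _ _).symm
      _ ≤ M * LCLT T m σ γ₂ := mul_le_mul_of_nonneg_left hl.sum_le hM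
      _ ≤ b := by rwa [mul_comm]

/-- The net marginal cost of a unit of loss in period `t` under the affine decision rule. -/
def netLossCost (T : ℕ) (β : ℕ → ℝ) (t : ℕ) : ℝ :=
  if t = T then 1 else 1 - β (t + 1)

theorem affine_coverage_eq {T : ℕ} (hT : 1 ≤ T) (α β l : ℕ → ℝ) :
    (α 1 + ∑ t ∈ Finset.Icc 2 T, (α t + β t * l (t - 1))) - ∑ t ∈ Finset.Icc 1 T, l t =
      ∑ t ∈ Finset.Icc 1 T, α t - ∑ t ∈ Finset.Icc 1 T, netLossCost T β t * l t := by
  obtain ⟨n, rfl⟩ := Nat.exists_eq_add_of_le' hT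
  have hcost : ∑ t ∈ Finset.Icc 1 (n + 1), netLossCost (n + 1) β t * l t =
      ∑ t ∈ Finset.Icc 1 n, (1 - β (t + 1)) * l t + l (n + 1) := by
    rw [Finset.sum_Icc_succ_top (by omega)]
    congr 1
    · refine Finset.sum_congr rfl fun t ht => ?_
      have := (Finset.mem_Icc.mp ht).2
      rw [netLossCost, if_neg (by omega)]
    · simp [netLossCost]
  rw [hcost]
  clear hcost hT
  induction n with
  | zero => simp
  | succ n ih =>
    rw [Finset.sum_Icc_succ_top (by omega : 2 ≤ n + 1 + 1),
      Finset.sum_Icc_succ_top (by omega : 1 ≤ n + 1 + 1) l,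
      Finset.sum_Icc_succ_top (by omega : 1 ≤ n + 1 + 1) α,
      Finset.sum_Icc_succ_top (by omega : 1 ≤ n + 1) fun t => (1 - β (t + 1)) * l t]
    simp only [Nat.add_sub_cancel]
    linarith

/-- Eliminating the dual variables: `s₁ = M`, `s₂ = 0` is the cheapest certificate. -/
theorem exists_dual_iff {A g M b : ℝ} (hA : 0 ≤ A) (hg : 0 ≤ g) (hM : 0 ≤ M) :
    (∃ s₁ s₂ : ℝ, 0 ≤ s₁ ∧ 0 ≤ s₂ ∧ M ≤ s₁ - s₂ ∧ (A + g) * s₁ + (g - A) * s₂ ≤ b) ↔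
      (A + g) * M ≤ b := by
  constructor
  · rintro ⟨s₁, s₂, -, h₂, hs, h⟩
    nlinarith [mul_le_mul_of_nonneg_left hs (add_nonneg hA hg), mul_nonneg hg h₂]
  · exact fun h => ⟨M, 0, hM, le_rfl, by simp, by simpa using h⟩

/-- (Robust counterpart of the loss-coverage constraint under the affine decision
rule `p 1 = α 1`, `p t = α t + β t · l (t−1)`.) The robust constraint holds iff a
dual certificate exists, equivalently iff
`∑ α ≥ δ + L^CLT · max(1, max_{2≤t≤T} (1 − β t))`. -/
theorem aro_coverage_robust_counterpart (T : ℕ) (hT2 : 2 ≤ T) (m σ γ₂ : ℝ)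
    (hm : 0 ≤ m) (hσ : 0 ≤ σ) (hγ : 0 ≤ γ₂) (α β : ℕ → ℝ) (δ : ℝ) :
    ((∀ l : ℕ → ℝ, UCLT T m σ γ₂ l →
        (α 1 + ∑ t ∈ Finset.Icc 2 T, (α t + β t * l (t - 1))) -
          (∑ t ∈ Finset.Icc 1 T, l t) ≥ δ) ↔
      (∃ s₁ s₂ : ℝ, 0 ≤ s₁ ∧ 0 ≤ s₂ ∧
        (∀ t ∈ Finset.Icc 2 T, s₁ - s₂ ≥ 1 - β t) ∧ s₁ - s₂ ≥ 1 ∧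
        -(∑ t ∈ Finset.Icc 1 T, α t) +
            ((T : ℝ) * m + γ₂ * σ * Real.sqrt T) * s₁ +
            (γ₂ * σ * Real.sqrt T - (T : ℝ) * m) * s₂ ≤ -δ)) ∧
    ((∀ l : ℕ → ℝ, UCLT T m σ γ₂ l →
        (α 1 + ∑ t ∈ Finset.Icc 2 T, (α t + β t * l (t - 1))) -
          (∑ t ∈ Finset.Icc 1 T, l t) ≥ δ) ↔
      (∑ t ∈ Finset.Icc 1 T, α t) ≥ δ +
        LCLT T m σ γ₂ *
          max 1 ((Finset.Icc 2 T).sup' (Finset.nonempty_Icc.mpr hT2) (fun t => 1 - β t))) := by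
  set M := max 1 ((Finset.Icc 2 T).sup' (Finset.nonempty_Icc.mpr hT2) (fun t => 1 - β t))
    with hMdef
  have hM : 0 ≤ M := zero_le_one.trans (le_max_left _ _)
  have hle_iff (x : ℝ) : M ≤ x ↔ (∀ t ∈ Finset.Icc 2 T, 1 - β t ≤ x) ∧ 1 ≤ x := by
    rw [hMdef, max_le_iff, Finset.sup'_le_iff, and_comm]
  have hle : ∀ t ∈ Finset.Icc 1 T, netLossCost T β t ≤ M := by
    intro t ht
    obtain ⟨hβ, hone⟩ := (hle_iff M).mp le_rfl
    rw [Finset.mem_Icc] at ht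
    unfold netLossCost
    split_ifs with h
    · exact hone
    · exact hβ _ (Finset.mem_Icc.mpr (by omega))
  have hex : ∃ t ∈ Finset.Icc 1 T, netLossCost T β t = M := by
    rcases max_choice 1 ((Finset.Icc 2 T).sup' (Finset.nonempty_Icc.mpr hT2)
      (fun t => 1 - β t)) with h | h
    · exact ⟨T, Finset.mem_Icc.mpr (by omega), by rw [hMdef, h, netLossCost, if_pos rfl]⟩
    · obtain ⟨k, hk, hkM⟩ := Finset.exists_mem_eq_sup' (Finset.nonempty_Icc.mpr hT2)
        (fun t => 1 - β t)
      have := Finset.mem_Icc.mp hk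
      refine ⟨k - 1, Finset.mem_Icc.mpr (by omega), ?_⟩
      rw [hMdef, h, hkM, netLossCost, if_neg (by omega), Nat.sub_add_cancel (by omega)]
  have hrobust : (∀ l : ℕ → ℝ, UCLT T m σ γ₂ l →
      (α 1 + ∑ t ∈ Finset.Icc 2 T, (α t + β t * l (t - 1))) -
        (∑ t ∈ Finset.Icc 1 T, l t) ≥ δ) ↔
      LCLT T m σ γ₂ * M ≤ ∑ t ∈ Finset.Icc 1 T, α t - δ := by
    rw [← forall_UCLT_sum_mul_le_iff hm hσ hγ hM hle hex]
    refine forall₂_congr fun l _ => ?_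
    rw [affine_coverage_eq (by omega), ge_iff_le, le_sub_comm]
  refine ⟨hrobust.trans ?_, hrobust.trans ?_⟩
  · rw [LCLT, ← exists_dual_iff (by positivity) (by positivity) hM]
    refine exists₂_congr fun s₁ s₂ => ?_
    rw [hle_iff, and_assoc]
    refine and_congr_right' (and_congr_right' (and_congr_right' (and_congr_right' ?_)))
    constructor <;> intro h <;> linarith
  · rw [ge_iff_le, le_sub_iff_add_le']
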